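/- Let λ > 0, T ∈ (0, ∞], and let u : ℝ × ℝ → ℝ be smooth, spatially periodic, and satisfy the μ-equation μ(u_t)(t) − u_txx + λ μ(u)(t) u_x − λ u_x u_xx − u u_xxx = 0 for all (t,x) with 0 ≤ t < T. Assume the initial datum satisfies μ(u)(0) − u_xx(0,x) ≥ 0 for all x ∈ ℝ. Then for all t ∈ [0,T) and all x ∈ ℝ: (i) μ(u)(t) − u_xx(t,x) ≥ 0, and (ii) |u_x(t,x)| ≤ (1/2) μ(u)(0). In particular the spatial derivative of the solution remains uniformly bounded for as long as the solution exists. -/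

import Mathlib

open intervalIntegral

/-- Partial derivative in the second (spatial) variable. -/
noncomputable def pdx (u : ℝ × ℝ → ℝ) : ℝ × ℝ → ℝ := fun p => deriv (fun y => u (p.1, y)) p.2

/-- Partial derivative in the first (time) variable. -/
noncomputable def pdt (u : ℝ × ℝ → ℝ) : ℝ × ℝ → ℝ := fun p => deriv (fun s => u (s, p.2)) p.1

/-- The spatial mean `μ(u)(t) = ∫₀¹ u(t,x) dx`. -/
noncomputable def muMean (u : ℝ × ℝ → ℝ) (t : ℝ) : ℝ := ∫ x in (0:ℝ)..1, u (t, x)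

open Set Filter Topology

lemma ContDiff.hasDerivAt_pdx {u : ℝ × ℝ → ℝ} (hu : ContDiff ℝ (⊤ : ℕ∞) u) (t x : ℝ) :
    HasDerivAt (fun y => u (t, y)) (pdx u (t, x)) x := by
  have h : DifferentiableAt ℝ (fun y => u (t, y)) x :=
    ((hu.differentiable (by simp)).comp
      ((differentiable_const t).prodMk differentiable_id)).differentiableAt
  exact h.hasDerivAt

lemma ContDiff.hasDerivAt_pdt {u : ℝ × ℝ → ℝ} (hu : ContDiff ℝ (⊤ : ℕ∞) u) (t x : ℝ) :
    HasDerivAt (fun s => u (s, x)) (pdt u (t, x)) t := by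
  have h : DifferentiableAt ℝ (fun s => u (s, x)) t :=
    ((hu.differentiable (by simp)).comp
      (differentiable_id.prodMk (differentiable_const x))).differentiableAt
  exact h.hasDerivAt

lemma ContDiff.pdx_eq_fderiv {u : ℝ × ℝ → ℝ} (hu : ContDiff ℝ (⊤ : ℕ∞) u) :
    pdx u = fun p => fderiv ℝ u p (0, 1) := by
  funext ⟨t, x⟩
  have h := (hu.differentiable (by simp) (t, x)).hasFDerivAt.comp_hasDerivAt x
    ((hasDerivAt_const x t).prodMk (hasDerivAt_id x))
  exact h.deriv

lemma ContDiff.pdt_eq_fderiv {u : ℝ × ℝ → ℝ} (hu : ContDiff ℝ (⊤ : ℕ∞) u) :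
    pdt u = fun p => fderiv ℝ u p (1, 0) := by
  funext ⟨t, x⟩
  have h := (hu.differentiable (by simp) (t, x)).hasFDerivAt.comp_hasDerivAt t
    ((hasDerivAt_id t).prodMk (hasDerivAt_const t x))
  exact h.deriv

lemma ContDiff.pdx {u : ℝ × ℝ → ℝ} (hu : ContDiff ℝ (⊤ : ℕ∞) u) :
    ContDiff ℝ (⊤ : ℕ∞) (pdx u) := by
  rw [hu.pdx_eq_fderiv]
  exact (hu.fderiv_right (by simp)).clm_apply contDiff_const

lemma ContDiff.pdt {u : ℝ × ℝ → ℝ} (hu : ContDiff ℝ (⊤ : ℕ∞) u) :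
    ContDiff ℝ (⊤ : ℕ∞) (pdt u) := by
  rw [hu.pdt_eq_fderiv]
  exact (hu.fderiv_right (by simp)).clm_apply contDiff_const

/-- Mixed partial derivatives of a smooth function commute. -/
lemma ContDiff.pdt_pdx {u : ℝ × ℝ → ℝ} (hu : ContDiff ℝ (⊤ : ℕ∞) u) :
    _root_.pdt (_root_.pdx u) = _root_.pdx (_root_.pdt u) := by
  rw [hu.pdx.pdt_eq_fderiv, hu.pdt.pdx_eq_fderiv, hu.pdx_eq_fderiv, hu.pdt_eq_fderiv]
  funext p
  have hd : DifferentiableAt ℝ (fderiv ℝ u) p :=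
    (hu.fderiv_right (m := (⊤ : ℕ∞)) (by simp)).differentiable (by simp) p
  have hs : IsSymmSndFDerivAt ℝ u p :=
    hu.contDiffAt.isSymmSndFDerivAt
      (by simpa using WithTop.coe_le_coe.2 (le_top (a := (2 : ℕ∞))))
  rw [fderiv_clm_apply hd (differentiableAt_const _),
    fderiv_clm_apply hd (differentiableAt_const _)]
  simpa using hs.eq (1, 0) (0, 1)

lemma pdx_add_one {u : ℝ × ℝ → ℝ} (hper : ∀ t x, u (t, x + 1) = u (t, x)) (t x : ℝ) :
    pdx u (t, x + 1) = pdx u (t, x) := by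
  simp only [pdx]
  rw [← deriv_comp_add_const (f := fun y => u (t, y)) (a := 1)]
  simp only [hper]

lemma pdt_add_one {u : ℝ × ℝ → ℝ} (hper : ∀ t x, u (t, x + 1) = u (t, x)) (t x : ℝ) :
    pdt u (t, x + 1) = pdt u (t, x) := by
  simp only [pdt, hper]

/-- Differentiation under the integral sign for the spatial mean. -/
lemma ContDiff.hasDerivAt_muMean {u : ℝ × ℝ → ℝ} (hu : ContDiff ℝ (⊤ : ℕ∞) u) (t : ℝ) :
    HasDerivAt (muMean u) (muMean (_root_.pdt u) t) t := by
  have hc : ∀ {f : ℝ × ℝ → ℝ}, ContDiff ℝ (⊤ : ℕ∞) f → ∀ s, Continuous fun x => f (s, x) :=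
    fun hf s => hf.continuous.comp (by fun_prop)
  obtain ⟨C, hC⟩ := ((isCompact_Icc (a := t - 1) (b := t + 1)).prod
    (isCompact_Icc (a := (0 : ℝ)) (b := 1))).exists_bound_of_continuousOn
      hu.pdt.continuous.continuousOn
  refine (intervalIntegral.hasDerivAt_integral_of_dominated_loc_of_deriv_le
    (F := fun s x => u (s, x)) (F' := fun s x => _root_.pdt u (s, x)) (bound := fun _ => C)
    (s := Icc (t - 1) (t + 1)) (Icc_mem_nhds (by linarith) (by linarith))
    (Eventually.of_forall fun s => (hc hu s).aestronglyMeasurable)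
    ((hc hu t).intervalIntegrable _ _) (hc hu.pdt t).aestronglyMeasurable
    (Eventually.of_forall fun x hx s hs => ?_) intervalIntegrable_const
    (Eventually.of_forall fun x _ s _ => hu.hasDerivAt_pdt s x)).2
  rw [uIoc_of_le zero_le_one] at hx
  exact hC (s, x) ⟨hs, Ioc_subset_Icc_self hx⟩

/-- A `1`-periodic function whose second derivative is at most `M` has first derivative bounded
by `M / 2`. -/
lemma abs_deriv_le_of_periodic_of_second_deriv_le {f f' f'' : ℝ → ℝ} {M : ℝ}
    (hf : ∀ x, HasDerivAt f (f' x) x) (hf' : ∀ x, HasDerivAt f' (f'' x) x)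
    (hper : ∀ x, f (x + 1) = f x) (hM : ∀ x, f'' x ≤ M) (x : ℝ) : |f' x| ≤ 1 / 2 * M := by
  have hanti : Antitone fun y => f' y - M * y :=
    antitone_of_hasDerivAt_nonpos (f' := fun y => f'' y - M * 1)
      (fun y => (hf' y).sub ((hasDerivAt_id y).const_mul M))
      fun y => by simpa using hM y
  have hh : ∀ y, HasDerivAt (fun y => f y - M / 2 * y ^ 2) (f' y - M * y) y := fun y =>
    ((hf y).sub ((hasDerivAt_pow 2 y).const_mul (M / 2))).congr_deriv (by simp; ring)
  have hslope : ∀ y, ∃ c ∈ Ioo y (y + 1), f' c - M * c = -(M * y) - M / 2 := fun y => by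
    obtain ⟨c, hc, h⟩ := exists_hasDerivAt_eq_slope _ _ (lt_add_one y)
      (fun z _ => (hh z).continuousAt.continuousWithinAt) fun z _ => hh z
    refine ⟨c, hc, h.trans ?_⟩
    rw [hper]
    simp only [add_sub_cancel_left, div_one]
    ring
  obtain ⟨c, hc, h⟩ := hslope x
  obtain ⟨d, hd, k⟩ := hslope (x - 1)
  have h₁ := hanti hc.1.le
  have h₂ := hanti (show d ≤ x by linarith [hd.2])
  simp only at h₁ h₂
  rw [abs_le]
  constructor <;> nlinarith

/-- Minimum principle: a spatially periodic solution of the linear transport equation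
`v_t + a v_x + c v = 0` with nonnegative initial datum stays nonnegative. -/
lemma nonneg_of_transport {v a c : ℝ × ℝ → ℝ} {τ : ℝ} (hv : ContDiff ℝ (⊤ : ℕ∞) v)
    (hc : Continuous c) (hper : ∀ t x, v (t, x + 1) = v (t, x))
    (heq : ∀ t ∈ Icc 0 τ, ∀ x, pdt v (t, x) = -(a (t, x) * pdx v (t, x) + c (t, x) * v (t, x)))
    (hinit : ∀ x, 0 ≤ v (0, x)) {t : ℝ} (ht : t ∈ Icc 0 τ) (x : ℝ) : 0 ≤ v (t, x) := by
  have hcpt : IsCompact (Icc 0 τ ×ˢ Icc (0 : ℝ) 1) := isCompact_Icc.prod isCompact_Icc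
  obtain ⟨C, hC⟩ := hcpt.exists_bound_of_continuousOn hc.continuousOn
  set w : ℝ × ℝ → ℝ := fun p => Real.exp (-(C + 1) * p.1) * v p with hw
  have hwc : Continuous w := by
    have := hv.continuous
    fun_prop
  obtain ⟨⟨s, y⟩, ⟨hs, hy⟩, hmin⟩ := hcpt.exists_isMinOn
    ⟨(t, 0), ht, left_mem_Icc.2 zero_le_one⟩ hwc.continuousOn
  have hglob : ∀ r ∈ Icc 0 τ, ∀ z, w (s, y) ≤ w (r, z) := fun r hr z => by
    have hp : Function.Periodic (fun z => w (r, z)) 1 := fun z => by simp only [hw, hper]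
    obtain ⟨z', hz', h⟩ := hp.exists_mem_Ico₀ one_pos z
    exact (hmin ⟨hr, Ico_subset_Icc_self hz'⟩).trans_eq h.symm
  by_contra! hneg
  have hsy : v (s, y) < 0 := by
    have h : w (s, y) < 0 :=
      (hglob t ht x).trans_lt (mul_neg_of_pos_of_neg (Real.exp_pos _) hneg)
    exact neg_of_mul_neg_right h (Real.exp_pos _).le
  have hs0 : 0 < s := hs.1.lt_of_ne fun h => by
    subst h
    exact hsy.not_ge (hinit y)
  have hx0 : pdx v (s, y) = 0 := by
    have : IsLocalMin (fun z => v (s, z)) y := Eventually.of_forall fun z =>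
      le_of_mul_le_mul_left (hglob s hs z) (Real.exp_pos _)
    exact this.deriv_eq_zero
  have hderiv : HasDerivAt (fun r => w (r, y))
      (Real.exp (-(C + 1) * s) * (-(c (s, y) + C + 1) * v (s, y))) s := by
    have h := (((hasDerivAt_id s).const_mul (-(C + 1))).exp).mul (hv.hasDerivAt_pdt s y)
    refine h.congr_deriv ?_
    rw [heq s hs y, hx0]
    simp only [id]
    ring
  have hle : Real.exp (-(C + 1) * s) * (-(c (s, y) + C + 1) * v (s, y)) ≤ 0 := by
    have htend : Tendsto (slope (fun r => w (r, y)) s) (𝓝[<] s) _ :=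
      (hasDerivAt_iff_tendsto_slope.1 hderiv).mono_left
        (nhdsWithin_mono s fun _ hr => ne_of_lt hr)
    refine le_of_tendsto htend ?_
    filter_upwards [Ioo_mem_nhdsLT hs0] with r hr
    rw [slope_def_field]
    exact div_nonpos_of_nonneg_of_nonpos
      (sub_nonneg.2 (hglob r ⟨hr.1.le, hr.2.le.trans hs.2⟩ y)) (sub_nonpos.2 hr.2.le)
  have hcs : -C ≤ c (s, y) := (abs_le.1 (hC (s, y) ⟨hs, hy⟩)).1
  refine hle.not_gt (mul_pos (Real.exp_pos _) ?_)
  exact mul_pos_of_neg_of_neg (by linarith) hsy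

/-- A solution of the `μ`-equation has `μ(u_t) = 0`. -/
lemma muMean_pdt_eq_zero {lam t : ℝ} {u : ℝ × ℝ → ℝ} (hu : ContDiff ℝ (⊤ : ℕ∞) u)
    (hper : ∀ t x, u (t, x + 1) = u (t, x))
    (heq : ∀ x : ℝ, muMean (pdt u) t - pdx (pdx (pdt u)) (t, x) + lam * muMean u t * pdx u (t, x)
        - lam * pdx u (t, x) * pdx (pdx u) (t, x) - u (t, x) * pdx (pdx (pdx u)) (t, x) = 0) :
    muMean (pdt u) t = 0 := by
  set F : ℝ → ℝ := fun x => pdx (pdt u) (t, x) - lam * muMean u t * u (t, x)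
    + (lam - 1) / 2 * pdx u (t, x) ^ 2 + u (t, x) * pdx (pdx u) (t, x) with hF
  have hd : ∀ x, HasDerivAt F (muMean (pdt u) t) x := fun x => by
    refine ((((hu.pdt.pdx.hasDerivAt_pdx t x).sub
      ((hu.hasDerivAt_pdx t x).const_mul (lam * muMean u t))).add
      (((hu.pdx.hasDerivAt_pdx t x).pow 2).const_mul ((lam - 1) / 2))).add
      ((hu.hasDerivAt_pdx t x).mul (hu.pdx.pdx.hasDerivAt_pdx t x))).congr_deriv ?_
    simp only [Nat.cast_ofNat, Nat.add_one_sub_one, pow_one]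
    linear_combination -heq x
  obtain ⟨c, -, h⟩ := exists_hasDerivAt_eq_slope F _ (lt_add_one (0 : ℝ))
    (fun z _ => (hd z).continuousAt.continuousWithinAt) fun z _ => hd z
  rw [h]
  simp only [hF, hper, pdx_add_one (pdt_add_one hper), pdx_add_one hper,
    pdx_add_one (pdx_add_one hper), sub_self, zero_div]

/-- for λ > 0, if the initial momentum density `μ(u)(0) − u_xx(0,·)` of a
solution of the μ-equation is nonnegative, then it stays nonnegative and the spatial
derivative satisfies the uniform bound `|u_x| ≤ (1/2) μ(u)(0)` on the whole lifespan. -/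
theorem mu_equation_sign_condition_bound
    (lam : ℝ) (hlam : 0 < lam) (T : EReal) (hT : 0 < T)
    (u : ℝ × ℝ → ℝ) (hu : ContDiff ℝ (⊤ : ℕ∞) u)
    (hper : ∀ t x, u (t, x + 1) = u (t, x))
    (heq : ∀ t x : ℝ, 0 ≤ t → (t : EReal) < T →
      muMean (pdt u) t - pdx (pdx (pdt u)) (t, x) + lam * muMean u t * pdx u (t, x)
        - lam * pdx u (t, x) * pdx (pdx u) (t, x) - u (t, x) * pdx (pdx (pdx u)) (t, x) = 0)
    (hsign : ∀ x : ℝ, 0 ≤ muMean u 0 - pdx (pdx u) (0, x)) :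
    ∀ t x : ℝ, 0 ≤ t → (t : EReal) < T →
      0 ≤ muMean u t - pdx (pdx u) (t, x) ∧
        |pdx u (t, x)| ≤ 1 / 2 * muMean u 0 := by
  intro t x ht htT
  have hlt : ∀ s ∈ Icc 0 t, (s : EReal) < T := fun s hs =>
    (EReal.coe_le_coe_iff.2 hs.2).trans_lt htT
  have hmean : ∀ s ∈ Icc 0 t, muMean u s = muMean u 0 :=
    constant_of_has_deriv_right_zero
      (fun s _ => (hu.hasDerivAt_muMean s).continuousAt.continuousWithinAt) fun s hs => by
        have h := hu.hasDerivAt_muMean s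
        rw [muMean_pdt_eq_zero hu hper
          fun z => heq s z hs.1 (hlt s (Ico_subset_Icc_self hs))] at h
        exact h.hasDerivWithinAt
  have hxx := hu.pdx.pdx
  have hcomm : pdt (pdx (pdx u)) = pdx (pdx (pdt u)) := by
    rw [hu.pdx.pdt_pdx, hu.pdt_pdx]
  have hnn : ∀ z, 0 ≤ muMean u 0 - pdx (pdx u) (t, z) := by
    refine nonneg_of_transport (v := fun p => muMean u 0 - pdx (pdx u) p) (a := u)
      (c := fun p => lam * pdx u p) (contDiff_const.sub hxx)
      (hu.pdx.continuous.const_mul lam)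
      (fun s z => by simp only [pdx_add_one (pdx_add_one hper)])
      (fun s hs z => ?_) hsign (right_mem_Icc.2 ht)
    have h₁ : pdt (fun p => muMean u 0 - pdx (pdx u) p) (s, z) = -pdx (pdx (pdt u)) (s, z) := by
      rw [← hcomm]
      exact ((hxx.hasDerivAt_pdt s z).const_sub _).deriv
    have h₂ : pdx (fun p => muMean u 0 - pdx (pdx u) p) (s, z) = -pdx (pdx (pdx u)) (s, z) :=
      ((hxx.hasDerivAt_pdx s z).const_sub _).deriv
    have h₃ := heq s z hs.1 (hlt s hs)
    rw [muMean_pdt_eq_zero hu hper fun z => heq s z hs.1 (hlt s hs), hmean s hs] at h₃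
    rw [h₁, h₂]
    linear_combination h₃
  refine ⟨by rw [hmean t (right_mem_Icc.2 ht)]; exact hnn x, ?_⟩
  exact abs_deriv_le_of_periodic_of_second_deriv_le (hu.hasDerivAt_pdx t)
    (hu.pdx.hasDerivAt_pdx t) (hper t) (fun z => sub_nonneg.1 (hnn z)) x
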